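/- Let k be a field and Λ = k[x]/(x³). The module V = Λ/(x) has universal deformation ring isomorphic to k[[t]]/(t³); concretely: the k[[t]]-algebra k[[t]] ⊗ Λ-module structure on k[[t]]/(t³) with x acting as multiplication by t defines a lift of V over k[[t]]/(t³), and every lift of V over an Artinian local k-algebra R with residue field k is obtained by base change along a unique k-algebra map k[[t]]/(t³) → R. -/

import Mathlib

noncomputable section

variable (k : Type) [Field k]

/-- The ring `k[[t]]/(t³)`. -/
abbrev Smod := PowerSeries k ⧸ Ideal.span ({PowerSeries.X ^ 3} : Set (PowerSeries k))

/-- The class `t` of the variable in `k[[t]]/(t³)`. -/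
def tbar : Smod k := Ideal.Quotient.mk _ PowerSeries.X

theorem aux_dvd (p : PowerSeries k) : ∃ r : PowerSeries k, p =
    algebraMap k (PowerSeries k) (PowerSeries.coeff 0 p)
    + algebraMap k (PowerSeries k) (PowerSeries.coeff 1 p) * PowerSeries.X
    + algebraMap k (PowerSeries k) (PowerSeries.coeff 2 p) * PowerSeries.X ^ 2
    + PowerSeries.X ^ 3 * r := by
  have h : (PowerSeries.X : PowerSeries k) ^ 3 ∣ p - (
    algebraMap k (PowerSeries k) (PowerSeries.coeff 0 p)
    + algebraMap k (PowerSeries k) (PowerSeries.coeff 1 p) * PowerSeries.X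
    + algebraMap k (PowerSeries k) (PowerSeries.coeff 2 p) * PowerSeries.X ^ 2) := by
    rw [PowerSeries.X_pow_dvd_iff]
    intro m hm
    interval_cases m <;>
      simp [PowerSeries.algebraMap_apply, PowerSeries.coeff_C, PowerSeries.coeff_X,
        PowerSeries.coeff_C_mul, PowerSeries.coeff_X_pow, -PowerSeries.coeff_zero_eq_constantCoeff]
  obtain ⟨r, hr⟩ := h
  exact ⟨r, by rw [← hr]; ring⟩

theorem tbar_cube : (tbar k) ^ 3 = 0 := by
  unfold tbar
  rw [← map_pow, Ideal.Quotient.eq_zero_iff_mem]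
  exact Ideal.subset_span rfl

theorem aux_ext {R : Type} [CommRing R] [Algebra k R] (f g : Smod k →ₐ[k] R)
    (h : f (tbar k) = g (tbar k)) : f = g := by
  apply AlgHom.ext
  intro x
  obtain ⟨p, rfl⟩ := Ideal.Quotient.mk_surjective x
  obtain ⟨r, hr⟩ := aux_dvd k p
  have key : ∀ c0 c1 c2 : k, (Ideal.Quotient.mk _ (
      algebraMap k (PowerSeries k) c0
    + algebraMap k (PowerSeries k) c1 * PowerSeries.X
    + algebraMap k (PowerSeries k) c2 * PowerSeries.X ^ 2
    + PowerSeries.X ^ 3 * r) : Smod k) = algebraMap k (Smod k) c0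
      + algebraMap k (Smod k) c1 * tbar k + algebraMap k (Smod k) c2 * tbar k ^ 2 := by
    intro c0 c1 c2
    have h3 := tbar_cube k
    unfold tbar at h3 ⊢
    rw [map_add, map_mul _ (PowerSeries.X ^ 3) r, map_pow _ _ 3, h3, zero_mul, add_zero]
    rw [map_add, map_add, map_mul, map_mul, map_pow]
    rfl
  rw [hr, key]
  simp only [map_add, map_mul, map_pow, AlgHom.commutes, h]

def auxHom {R : Type} [CommRing R] [Algebra k R] (a : R) (ha : a ^ 3 = 0) :
    PowerSeries k →ₐ[k] R where
  toFun p := algebraMap k R (PowerSeries.coeff 0 p) + algebraMap k R (PowerSeries.coeff 1 p) * a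
    + algebraMap k R (PowerSeries.coeff 2 p) * a ^ 2
  map_one' := by simp [PowerSeries.coeff_one]
  map_zero' := by simp
  map_add' p q := by simp only [map_add]; ring
  map_mul' p q := by
    have h1 : Finset.HasAntidiagonal.antidiagonal 1 = {((0 : ℕ), (1 : ℕ)), (1, 0)} := rfl
    have h2 : Finset.HasAntidiagonal.antidiagonal 2 = {((0 : ℕ), (2 : ℕ)), (1, 1), (2, 0)} := rfl
    simp only [PowerSeries.coeff_mul, h1, h2, Finset.HasAntidiagonal.antidiagonal_zero, Finset.sum_singleton]
    rw [Finset.sum_pair (by decide), Finset.sum_insert (by decide), Finset.sum_pair (by decide)]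
    simp only [map_add, map_mul]
    generalize algebraMap k R (PowerSeries.coeff 0 p) = p0
    generalize algebraMap k R (PowerSeries.coeff 1 p) = p1
    generalize algebraMap k R (PowerSeries.coeff 2 p) = p2
    generalize algebraMap k R (PowerSeries.coeff 0 q) = q0
    generalize algebraMap k R (PowerSeries.coeff 1 q) = q1
    generalize algebraMap k R (PowerSeries.coeff 2 q) = q2
    linear_combination (-(p1 * q2 + p2 * q1) - p2 * q2 * a) * ha
  commutes' c := by
    simp [PowerSeries.algebraMap_apply, PowerSeries.coeff_C]

theorem auxHom_X {R : Type} [CommRing R] [Algebra k R] (a : R) (ha : a ^ 3 = 0) :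
    auxHom k a ha PowerSeries.X = a := by
  simp [auxHom, PowerSeries.coeff_X]

theorem aux_exists {R : Type} [CommRing R] [Algebra k R] (a : R) (ha : a ^ 3 = 0) :
    ∃ f : Smod k →ₐ[k] R, f (tbar k) = a := by
  refine ⟨Ideal.Quotient.liftₐ _ (auxHom k a ha) ?_, ?_⟩
  · intro x hx
    obtain ⟨r, rfl⟩ := Ideal.mem_span_singleton.1 hx
    rw [map_mul, map_pow, auxHom_X, ha, zero_mul]
  · exact auxHom_X k a ha

/-- Let `Λ = k[x]/(x³)` and let `V = Λ/(x)` be the simple module (so `V = k` with `x`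
acting as `0`).  The universal deformation ring of `V` is `k[[t]]/(t³)`:

* letting `x` act on `k[[t]]/(t³)` as multiplication by `t` defines a lift of `V` over
  `k[[t]]/(t³)` (i.e. `t³ = 0` and `t` lies in the maximal ideal, so the action
  reduces to `0` modulo the maximal ideal); and
* for every commutative Artinian local `k`-algebra `R` with residue field `k`, every
  lift of `V` over `R` — i.e. every finite free `R`-module `M` of rank `1` with an
  `R`-linear action `u` of `x` satisfying `u³ = 0` whose reduction modulo the maximal
  ideal is `V` (i.e. `u(M) ⊆ m_R·M`) — is obtained by base change from the universal
  lift along a unique `k`-algebra homomorphism `ψ : k[[t]]/(t³) → R`, i.e. there is a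
  unique `ψ` such that `(M, u)` is isomorphic to `(R, ψ(t)·)`. -/
theorem stmt_15 :
    ((tbar k) ^ 3 = 0 ∧ tbar k ∈ nonunits (Smod k)) ∧
    ∀ (R : Type) [CommRing R] [Algebra k R] [IsArtinianRing R] [IsLocalRing R],
      Function.Bijective ((IsLocalRing.residue R).comp (algebraMap k R)) →
      ∀ (M : Type) [AddCommGroup M] [Module R M] [Module.Free R M] [Module.Finite R M],
        Module.finrank R M = 1 →
        ∀ (u : M →ₗ[R] M), u ∘ₗ u ∘ₗ u = 0 →
          (∀ m : M, u m ∈ (IsLocalRing.maximalIdeal R) • (⊤ : Submodule R M)) →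
          ∃! ψ : Smod k →ₐ[k] R,
            ∃ e : M ≃ₗ[R] R, ∀ m : M, e (u m) = ψ (tbar k) * e m := by
  refine ⟨⟨tbar_cube k, ?_⟩, ?_⟩
  · intro hu
    have h0 := hu.pow 3
    rw [tbar_cube, isUnit_zero_iff] at h0
    have h1 : (Ideal.Quotient.mk (Ideal.span ({PowerSeries.X ^ 3} : Set (PowerSeries k)))) 1 = 0 :=
      h0.symm
    rw [Ideal.Quotient.eq_zero_iff_mem, Ideal.mem_span_singleton, PowerSeries.X_pow_dvd_iff] at h1
    have := h1 0 (by norm_num)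
    simp at this
  · intro R _ _ _ _ _ M _ _ _ _ hM u hu _
    let e0 : M ≃ₗ[R] R := LinearEquiv.ofFinrankEq M R (by rw [hM, Module.finrank_self])
    obtain ⟨a, hua⟩ : ∃ a : R, ∀ m, u m = a • m := by
      refine ⟨e0 (u (e0.symm 1)), fun m => e0.injective ?_⟩
      have hm : m = e0 m • e0.symm 1 := e0.injective (by simp)
      conv_lhs => rw [hm]
      simp [mul_comm]
    have ha : a ^ 3 = 0 := by
      have h := congrArg e0 (LinearMap.congr_fun hu (e0.symm 1))
      simp [hua] at h
      linear_combination h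
    obtain ⟨f, hf⟩ := aux_exists k a ha
    refine ⟨f, ⟨e0, fun m => by simp [hua, hf]⟩, ?_⟩
    rintro g ⟨e, he⟩
    apply aux_ext
    have h := he (e.symm 1)
    simp [hua] at h
    rw [hf, h]
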